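/- Let W ⊂ ℝ^d be a two-dimensional linear subspace and let a₁,…,a_n ∈ ℝ^d be independent random vectors, each with an L-log-Lipschitz probability density. For every I ∈ ([n] choose d) with Pr[E_I] ≥ 10·(n choose d)^{−1}, Pr[ min_{k ∈ [n]∖I} dist(affhull(F_I), a_k) ≥ 1/(10e³ d L log n) | E_I ] ≥ 0.72. -/

import Mathlib

open MeasureTheory Set
open scoped ENNReal ProbabilityTheory Pointwise RealInnerProductSpace

noncomputable section

abbrev Euc (d : ℕ) := EuclideanSpace ℝ (Fin d)

/-- Number of edges (one-dimensional exposed faces) of a set. -/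
def edgeCount {d : ℕ} (S : Set (Euc d)) : ℕ :=
  Set.ncard {F : Set (Euc d) | IsExposed ℝ S F ∧ Module.finrank ℝ (vectorSpan ℝ F) = 1}

/-- A probability density is `L`-log-Lipschitz. -/
def IsLogLipschitz {E : Type*} [NormedAddCommGroup E] (L : ℝ) (f : E → ℝ) : Prop :=
  (∀ x, 0 < f x) ∧ ∀ x y, f x ≤ Real.exp (L * ‖x - y‖) * f y

/-- Joint law of `n` independent points in `ℝ^d`, the `i`-th having density `f i`. -/
def productDensityMeasure {n d : ℕ} (f : Fin n → Euc d → ℝ) :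
    Measure (Fin n → Euc d) :=
  volume.withDensity fun ω => ENNReal.ofReal (∏ i, f i (ω i))

/-- `F` is a facet ((d-1)-dimensional exposed proper face) of `Q ⊆ ℝ^d`. -/
def IsFacet {d : ℕ} (Q F : Set (Euc d)) : Prop :=
  IsExposed ℝ Q F ∧ F ≠ Q ∧ Module.finrank ℝ (vectorSpan ℝ F) + 1 = d

/-- `R` is a ridge ((d-2)-dimensional exposed face) of `Q ⊆ ℝ^d`. -/
def IsRidge {d : ℕ} (Q R : Set (Euc d)) : Prop :=
  IsExposed ℝ Q R ∧ Module.finrank ℝ (vectorSpan ℝ R) + 2 = d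

/-- The edge event `E_I`: `conv(a_i : i ∈ I)` is a facet of `conv(a_1,…,a_n)` and it meets `W`. -/
def edgeEvent {n d : ℕ} (W : Submodule ℝ (Euc d)) (I : Finset (Fin n)) :
    Set (Fin n → Euc d) :=
  {ω | IsFacet (convexHull ℝ (Set.range ω)) (convexHull ℝ (ω '' ↑I)) ∧
    (convexHull ℝ (ω '' ↑I) ∩ ↑W).Nonempty}

/-- The vertex event `A_J`: `conv(a_j : j ∈ J)` is a ridge of `conv(a_1,…,a_n)` meeting `W`. -/
def vertexEvent {n d : ℕ} (W : Submodule ℝ (Euc d)) (J : Finset (Fin n)) :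
    Set (Fin n → Euc d) :=
  {ω | IsRidge (convexHull ℝ (Set.range ω)) (convexHull ℝ (ω '' ↑J)) ∧
    (convexHull ℝ (ω '' ↑J) ∩ ↑W).Nonempty}

/-- `y` is an outer unit normal, within the subspace `W`, of the face `e` of `S`:
`y ∈ W` is a unit vector whose inner product with points of `S` is maximized exactly
at the points of `e`. -/
def IsOuterNormal {d : ℕ} (W : Submodule ℝ (Euc d)) (S e : Set (Euc d)) (y : Euc d) : Prop :=
  y ∈ W ∧ ‖y‖ = 1 ∧ ∀ p ∈ e, ∀ q ∈ S, ⟪y, q⟫ ≤ ⟪y, p⟫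

/-- With respect to the orientation form `o` (an alternating bilinear form which is
non-degenerate on the plane of interest), the segment `[p₁, p₂]` is an edge of the planar
convex set `S` and `p₂` is its second endpoint in clockwise order: all of `S` lies on the
non-positive side of the oriented line through `p₁, p₂`.  Consequently, "the next vertex of
`S` after the edge `[p₁,p₂]` in clockwise order" is the point `p₃` with
`IsClockwiseEdge o S p₂ p₃`. -/
def IsClockwiseEdge {d : ℕ} (o : Euc d →ₗ[ℝ] Euc d →ₗ[ℝ] ℝ) (S : Set (Euc d))
    (p₁ p₂ : Euc d) : Prop :=
  p₁ ≠ p₂ ∧ IsExposed ℝ S (segment ℝ p₁ p₂) ∧ ∀ q ∈ S, o (p₂ - p₁) (q - p₁) ≤ 0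

theorem IsLogLipschitz.continuous {E : Type*} [NormedAddCommGroup E] {L : ℝ} {f : E → ℝ}
    (hL : 0 < L) (hf : IsLogLipschitz L f) : Continuous f := by
  have hlog : LipschitzWith L.toNNReal fun x => Real.log (f x) := by
    refine LipschitzWith.of_le_add_mul _ fun x y => ?_
    have h := Real.log_le_log (hf.1 x) (hf.2 x y)
    rw [Real.log_mul (Real.exp_ne_zero _) (hf.1 y).ne', Real.log_exp] at h
    rw [Real.coe_toNNReal _ hL.le, dist_eq_norm]
    linarith
  have hexp : f = fun x => Real.exp (Real.log (f x)) := funext fun x => (Real.exp_log (hf.1 x)).symm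
  rw [hexp]
  exact Real.continuous_exp.comp hlog.continuous

/-- The product of the laws with densities `f i` has density `∏ i, f i`. -/
theorem productDensityMeasure_eq_pi {n d : ℕ} {f : Fin n → Euc d → ℝ}
    (hcont : ∀ i, Continuous (f i)) (hpos : ∀ i x, 0 < f i x)
    (hnorm : ∀ i, ∫⁻ x, ENNReal.ofReal (f i x) = 1) :
    productDensityMeasure f =
      Measure.pi fun i => volume.withDensity fun x => ENNReal.ofReal (f i x) := by
  have hprob : ∀ i, IsProbabilityMeasure (volume.withDensity fun x => ENNReal.ofReal (f i x)) :=
    fun i => ⟨by simp [hnorm i]⟩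
  symm
  refine Measure.pi_eq fun s hs => ?_
  have hint : ∀ i, Integrable ((s i).indicator (f i)) := fun i => by
    refine Integrable.indicator ⟨(hcont i).aestronglyMeasurable, ?_⟩ (hs i)
    rw [hasFiniteIntegral_iff_ofReal (ae_of_all _ fun x => (hpos i x).le), hnorm i]
    exact ENNReal.one_lt_top
  have hnn : ∀ i x, 0 ≤ (s i).indicator (f i) x := fun i x =>
    indicator_nonneg (fun y _ => (hpos i y).le) x
  have hind : ∀ i, (volume.withDensity fun x => ENNReal.ofReal (f i x)) (s i) =
      ENNReal.ofReal (∫ x, (s i).indicator (f i) x) := fun i => by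
    rw [withDensity_apply _ (hs i), ofReal_integral_eq_lintegral_ofReal (hint i)
      (ae_of_all _ (hnn i)), ← lintegral_indicator (hs i)]
    refine lintegral_congr fun x => ?_
    by_cases hx : x ∈ s i <;> simp [hx]
  have hintprod : Integrable fun ω : Fin n → Euc d => ∏ i, (s i).indicator (f i) (ω i) :=
    Integrable.fintype_prod hint
  simp_rw [hind]
  rw [← ENNReal.ofReal_prod_of_nonneg fun i _ => integral_nonneg (hnn i),
    ← integral_fintype_prod_volume_eq_prod, ofReal_integral_eq_lintegral_ofReal hintprod
      (ae_of_all _ fun ω => Finset.prod_nonneg fun i _ => hnn i _),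
    productDensityMeasure, withDensity_apply _ (MeasurableSet.univ_pi hs),
    ← lintegral_indicator (MeasurableSet.univ_pi hs)]
  refine lintegral_congr fun ω => ?_
  by_cases hω : ω ∈ Set.univ.pi s
  · rw [indicator_of_mem hω]
    congr 1
    exact Finset.prod_congr rfl fun i _ => (indicator_of_mem (hω i (mem_univ i)) _).symm
  · rw [indicator_of_notMem hω]
    obtain ⟨i, hi⟩ : ∃ i, ω i ∉ s i := by simpa [Set.mem_pi] using hω
    rw [Finset.prod_eq_zero (Finset.mem_univ i) (indicator_of_notMem hi _), ENNReal.ofReal_zero]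

/-- Translating a set by `v` changes its mass under an `L`-log-Lipschitz density by a factor of
at most `exp (L * ‖v‖)`. -/
theorem IsLogLipschitz.measure_preimage_add_le {d : ℕ} {L : ℝ} {f : Euc d → ℝ}
    (hf : IsLogLipschitz L f) (v : Euc d) {s : Set (Euc d)} (hs : MeasurableSet s) :
    (volume.withDensity fun x => ENNReal.ofReal (f x)) ((fun x => x + v) ⁻¹' s) ≤
      ENNReal.ofReal (Real.exp (L * ‖v‖)) *
        (volume.withDensity fun x => ENNReal.ofReal (f x)) s := by
  have hs' : MeasurableSet ((fun x => x + v) ⁻¹' s) := measurable_add_const v hs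
  rw [withDensity_apply _ hs', withDensity_apply _ hs, ← lintegral_indicator hs',
    ← lintegral_indicator hs, ← lintegral_const_mul' _ _ ENNReal.ofReal_ne_top,
    ← lintegral_add_right_eq_self (fun x => ENNReal.ofReal (Real.exp (L * ‖v‖)) * _) v]
  refine lintegral_mono fun x => ?_
  by_cases hx : x + v ∈ s
  · rw [indicator_of_mem (show x ∈ (fun x => x + v) ⁻¹' s from hx), indicator_of_mem hx,
      ← ENNReal.ofReal_mul (Real.exp_nonneg _)]
    refine ENNReal.ofReal_le_ofReal ?_
    simpa using hf.2 x (x + v)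
  · rw [indicator_of_notMem (show x ∉ (fun x => x + v) ⁻¹' s from hx)]
    exact bot_le

/-- Shrinking a half-space of mass `q` by a small amount leaves a mass `r ≥ q ^ (1 + 4 * c)`. -/
theorem rpow_le_of_mass_bounds {q r c : ℝ} (hq0 : 0 < q) (hq1 : q ≤ 1) (hc0 : 0 ≤ c)
    (hc1 : c ≤ 1 / 80) (hmul : q ≤ Real.exp c * r) (hcompl : 1 - r ≤ Real.exp c * (1 - q)) :
    q * q ^ (4 * c) ≤ r := by
  have hpow : q ^ (4 * c) = Real.exp (Real.log q * (4 * c)) := Real.rpow_def_of_pos hq0 _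
  rw [hpow]
  rcases le_total q (1 / 2) with h | h
  · have hlog : Real.log q ≤ - Real.log 2 := by
      rw [← Real.log_inv]
      exact Real.log_le_log hq0 (by simpa using h)
    have h2 := Real.log_two_gt_d9
    have hle : Real.exp (Real.log q * (4 * c)) ≤ Real.exp (-c) :=
      Real.exp_le_exp.2 (by nlinarith)
    calc q * Real.exp (Real.log q * (4 * c)) ≤ (Real.exp c * r) * Real.exp (-c) :=
          mul_le_mul hmul hle (Real.exp_nonneg _) (hq0.le.trans hmul)
      _ = r := by rw [mul_right_comm, ← Real.exp_add]; simp
  · have hlog : Real.log q ≤ q - 1 := Real.log_le_sub_one_of_pos hq0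
    set y := 4 * c * (1 - q) with hy
    have hy0 : 0 ≤ y := mul_nonneg (by positivity) (by linarith)
    have hy1 : y ≤ 1 / 40 := by nlinarith
    have hle : Real.exp (Real.log q * (4 * c)) ≤ Real.exp (-y) :=
      Real.exp_le_exp.2 (by nlinarith)
    have hexpy : Real.exp (-y) ≤ 1 - y * (9 / 10) := by
      have h1 : 1 + y ≤ Real.exp y := by linarith [Real.add_one_le_exp y]
      have h2 : Real.exp (-y) * Real.exp y = 1 := by rw [← Real.exp_add]; simp
      have h3 := Real.exp_pos (-y)
      nlinarith
    have hexpc : Real.exp c ≤ 1 + c * (11 / 10) := by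
      have h1 : 1 - c ≤ Real.exp (-c) := by linarith [Real.add_one_le_exp (-c)]
      have h2 : Real.exp (-c) * Real.exp c = 1 := by rw [← Real.exp_add]; simp
      have h3 := Real.exp_pos c
      nlinarith
    have hr : q - c * (11 / 10) * (1 - q) ≤ r := by nlinarith
    have : q * Real.exp (Real.log q * (4 * c)) ≤ q * (1 - y * (9 / 10)) := by gcongr; linarith
    have hcq : 0 ≤ c * (1 - q) := mul_nonneg hc0 (by linarith)
    nlinarith

/-- If each `r i` is bounded below in terms of `q i` as for shrunken half-spaces, then passing from
`∏ q` to `∏ r` loses a factor of at most `9 / 10`, unless `∏ q` is smaller than `δ`. -/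
theorem prod_mass_le {ι : Type*} [Fintype ι] {q r : ι → ℝ} {c δ : ℝ} (hq0 : ∀ i, 0 ≤ q i)
    (hq1 : ∀ i, q i ≤ 1) (hr0 : ∀ i, 0 ≤ r i) (hc0 : 0 ≤ c) (hc1 : c ≤ 1 / 80) (hδ0 : 0 < δ)
    (hδ : 9 / 10 ≤ δ ^ (4 * c)) (hmul : ∀ i, q i ≤ Real.exp c * r i)
    (hcompl : ∀ i, 1 - r i ≤ Real.exp c * (1 - q i)) :
    9 / 10 * ∏ i, q i ≤ ∏ i, r i + 9 / 10 * δ := by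
  have hr : 0 ≤ ∏ i, r i := Finset.prod_nonneg fun i _ => hr0 i
  rcases le_total (∏ i, q i) δ with h | h
  · linarith
  have hpos : ∀ i, 0 < q i := fun i => (hq0 i).lt_of_ne' fun h0 =>
    (hδ0.trans_le h).ne' (Finset.prod_eq_zero (Finset.mem_univ i) h0)
  have hle : (∏ i, q i) * (∏ i, q i) ^ (4 * c) ≤ ∏ i, r i := by
    rw [← Real.finsetProd_rpow _ _ fun i _ => hq0 i, ← Finset.prod_mul_distrib]
    exact Finset.prod_le_prod (fun i _ => mul_nonneg (hq0 i) (Real.rpow_nonneg (hq0 i) _))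
      fun i _ => rpow_le_of_mass_bounds (hpos i) (hq1 i) hc0 hc1 (hmul i) (hcompl i)
  have hpow : δ ^ (4 * c) ≤ (∏ i, q i) ^ (4 * c) :=
    Real.rpow_le_rpow hδ0.le h (by positivity)
  nlinarith

/-- Comparison of the probabilities that independent points all lie in a half-space, respectively
in the half-space shrunk by `ε`. -/
theorem prod_halfSpace_le {ι : Type*} [Fintype ι] {d : ℕ} {L ε δ : ℝ} (μ : ι → Measure (Euc d))
    [∀ i, IsProbabilityMeasure (μ i)]
    (htrans : ∀ i (v : Euc d) (s : Set (Euc d)), MeasurableSet s →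
      μ i ((fun x => x + v) ⁻¹' s) ≤ ENNReal.ofReal (Real.exp (L * ‖v‖)) * μ i s)
    (hL : 0 ≤ L) (hε0 : 0 ≤ ε) (hε1 : L * ε ≤ 1 / 80) (hδ0 : 0 < δ)
    (hδ : 9 / 10 ≤ δ ^ (4 * (L * ε))) (θ : Euc d) (hθ : ‖θ‖ = 1) (t : ℝ) :
    ENNReal.ofReal (9 / 10) * ∏ i, μ i {x | ⟪θ, x⟫ ≤ t} ≤
      ∏ i, μ i {x | ⟪θ, x⟫ ≤ t - ε} + ENNReal.ofReal (9 / 10 * δ) := by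
  have hmeas : ∀ u : ℝ, MeasurableSet {x : Euc d | ⟪θ, x⟫ ≤ u} := fun u =>
    (isClosed_le (by fun_prop) continuous_const).measurableSet
  have hreal : ∀ i (v : Euc d) (s : Set (Euc d)), MeasurableSet s → ‖v‖ = ε →
      (μ i).real ((fun x => x + v) ⁻¹' s) ≤ Real.exp (L * ε) * (μ i).real s := by
    intro i v s hs hv
    have h := ENNReal.toReal_mono (by finiteness) (htrans i v s hs)
    rwa [ENNReal.toReal_mul, ENNReal.toReal_ofReal (Real.exp_nonneg _), hv] at h
  have hnorm : ‖ε • θ‖ = ε := by rw [norm_smul, hθ, mul_one, Real.norm_of_nonneg hε0]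
  have hmul : ∀ i, (μ i).real {x | ⟪θ, x⟫ ≤ t} ≤
      Real.exp (L * ε) * (μ i).real {x | ⟪θ, x⟫ ≤ t - ε} := fun i => by
    convert hreal i (-(ε • θ)) _ (hmeas (t - ε)) (by rw [norm_neg, hnorm]) using 2
    ext x
    simp [inner_add_right, inner_smul_right, hθ]
  have hcompl : ∀ i, 1 - (μ i).real {x | ⟪θ, x⟫ ≤ t - ε} ≤
      Real.exp (L * ε) * (1 - (μ i).real {x | ⟪θ, x⟫ ≤ t}) := fun i => by
    rw [← probReal_compl_eq_one_sub (hmeas _), ← probReal_compl_eq_one_sub (hmeas _)]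
    convert hreal i (ε • θ) _ (hmeas t).compl hnorm using 2
    ext x
    simp [inner_add_right, inner_smul_right, hθ, sub_lt_iff_lt_add]
  have h := prod_mass_le (fun i => measureReal_nonneg) (fun i => measureReal_le_one)
    (fun i => measureReal_nonneg) (mul_nonneg hL hε0) hε1 hδ0 hδ hmul hcompl
  have hprod : ∀ u : ℝ, ∏ i, μ i {x | ⟪θ, x⟫ ≤ u} =
      ENNReal.ofReal (∏ i, (μ i).real {x | ⟪θ, x⟫ ≤ u}) := fun u => by
    rw [ENNReal.ofReal_prod_of_nonneg fun i _ => measureReal_nonneg]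
    exact Finset.prod_congr rfl fun i _ => (ofReal_measureReal (by finiteness)).symm
  rw [hprod, hprod, ← ENNReal.ofReal_mul (by norm_num), ← ENNReal.ofReal_add
    (Finset.prod_nonneg fun i _ => measureReal_nonneg) (by positivity)]
  exact ENNReal.ofReal_le_ofReal h

/-- The convex hull of a finite family is the set of its weighted averages. -/
theorem mem_convexHull_range_iff {ι E : Type*} [Fintype ι] [AddCommGroup E] [Module ℝ E]
    (a : ι → E) (x : E) :
    x ∈ convexHull ℝ (range a) ↔ ∃ w ∈ stdSimplex ℝ ι, ∑ i, w i • a i = x := by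
  classical
  have h : convexHull ℝ (range a) = Fintype.linearCombination ℝ a '' stdSimplex ℝ ι := by
    rw [← convexHull_rangle_single_eq_stdSimplex, LinearMap.image_convexHull, ← range_comp]
    congr 2
    ext i
    simp [Fintype.linearCombination_apply_single]
  simp [h, Fintype.linearCombination_apply]

theorem isClosed_convexHull_range_inter_nonempty {ι : Type*} [Fintype ι] {d : ℕ}
    (W : Submodule ℝ (Euc d)) :
    IsClosed {a : ι → Euc d | (convexHull ℝ (range a) ∩ W).Nonempty} := by
  have hcompact : CompactSpace (stdSimplex ℝ ι) :=
    isCompact_iff_compactSpace.1 (isCompact_stdSimplex ℝ ι)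
  have hclosed : IsClosed {p : stdSimplex ℝ ι × (ι → Euc d) | ∑ i, p.1.1 i • p.2 i ∈ W} :=
    W.closed_of_finiteDimensional.preimage (f := fun p : stdSimplex ℝ ι × (ι → Euc d) =>
      ∑ i, p.1.1 i • p.2 i) <| continuous_finsetSum _ fun i _ =>
        ((continuous_apply i).comp (continuous_subtype_val.comp continuous_fst)).smul (by fun_prop)
  convert isClosedMap_snd_of_compactSpace _ hclosed
  ext a
  simp [Set.Nonempty, mem_convexHull_range_iff]

theorem isClosed_exists_unit_normal {n d : ℕ} (I : Finset (Fin n)) :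
    IsClosed {ω : Fin n → Euc d | ∃ θ : Euc d, ‖θ‖ = 1 ∧
      ∀ i ∈ I, ∀ k, ⟪θ, ω k⟫ ≤ ⟪θ, ω i⟫} := by
  have hclosed : IsClosed {p : Metric.sphere (0 : Euc d) 1 × (Fin n → Euc d) |
      ∀ i ∈ I, ∀ k, ⟪p.1.1, p.2 k⟫ ≤ ⟪p.1.1, p.2 i⟫} := by
    simp only [ofPred_forall]
    refine isClosed_iInter fun i => isClosed_iInter fun _ => isClosed_iInter fun k => ?_
    exact isClosed_le (by fun_prop) (by fun_prop)
  convert isClosedMap_snd_of_compactSpace _ hclosed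
  ext ω
  simp

/-- A measurable (locally closed) set which contains the edge event. -/
def supportedEvent {n d : ℕ} (W : Submodule ℝ (Euc d)) (I : Finset (Fin n)) :
    Set (Fin n → Euc d) :=
  {ω | AffineIndependent ℝ (fun i : {i // i ∈ I} => ω i) ∧
    (convexHull ℝ (range fun i : {i // i ∈ I} => ω i) ∩ W).Nonempty ∧
    ∃ θ : Euc d, ‖θ‖ = 1 ∧ ∀ i ∈ I, ∀ k, ⟪θ, ω k⟫ ≤ ⟪θ, ω i⟫}

theorem measurableSet_supportedEvent {n d : ℕ} (W : Submodule ℝ (Euc d)) (I : Finset (Fin n)) :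
    MeasurableSet (supportedEvent W I) := by
  have hrestr : Continuous fun (ω : Fin n → Euc d) (i : {i // i ∈ I}) => ω i := by fun_prop
  exact (isOpen_setOfPred_affineIndependent.preimage hrestr).measurableSet.inter
    (((isClosed_convexHull_range_inter_nonempty W).preimage hrestr).measurableSet.inter
      (isClosed_exists_unit_normal I).measurableSet)

theorem image_coe_eq_range {n d : ℕ} (ω : Fin n → Euc d) (I : Finset (Fin n)) :
    ω '' (I : Set (Fin n)) = range fun i : {i // i ∈ I} => ω i :=
  image_eq_range ω _

theorem vectorSpan_convexHull {d : ℕ} (s : Set (Euc d)) :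
    vectorSpan ℝ (convexHull ℝ s) = vectorSpan ℝ s := by
  rw [← direction_affineSpan, affineSpan_convexHull, direction_affineSpan]

theorem edgeEvent_subset_supportedEvent {n d : ℕ} (W : Submodule ℝ (Euc d)) (I : Finset (Fin n))
    (hI : I.card = d) : edgeEvent W I ⊆ supportedEvent W I := by
  rintro ω ⟨⟨hexp, hne, hrank⟩, hW⟩
  obtain ⟨l, hl⟩ := hexp (hW.mono inter_subset_left)
  rw [vectorSpan_convexHull, image_coe_eq_range] at hrank
  refine ⟨?_, by rwa [← image_coe_eq_range], ?_⟩
  · rw [affineIndependent_iff_finrank_vectorSpan_eq ℝ _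
      (n := d - 1) (by rw [Fintype.card_coe]; omega)]
    omega
  · have hl0 : l ≠ 0 := by
      rintro rfl
      exact hne (by simpa using hl)
    set v := (InnerProductSpace.toDual ℝ (Euc d)).symm l with hv
    have hv0 : 0 < ‖v‖ := by
      rw [hv, LinearIsometryEquiv.norm_map]
      exact norm_pos_iff.2 hl0
    have hvl : ∀ x, ⟪v, x⟫ = l x := fun x => InnerProductSpace.toDual_symm_apply
    refine ⟨‖v‖⁻¹ • v, by rw [norm_smul, norm_inv, norm_norm, inv_mul_cancel₀ hv0.ne'], ?_⟩
    intro i hi k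
    have hmem : ω i ∈ convexHull ℝ (ω '' (I : Set (Fin n))) :=
      subset_convexHull ℝ _ (mem_image_of_mem ω hi)
    rw [hl] at hmem
    rw [real_inner_smul_left, real_inner_smul_left, hvl, hvl]
    exact mul_le_mul_of_nonneg_left (hmem.2 _ (subset_convexHull ℝ _ (mem_range_self k)))
      (by positivity)

/-- The hyperplane through `d` affinely independent points of `ℝ^d` has exactly two unit
normals. -/
theorem exists_unit_normal {ι : Type*} [Fintype ι] {d : ℕ} (hd : 1 ≤ d)
    (hcard : Fintype.card ι = d) {a : ι → Euc d} (ha : AffineIndependent ℝ a) :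
    ∃ (θ : Euc d) (t : ℝ), ‖θ‖ = 1 ∧ (∀ i, ⟪θ, a i⟫ = t) ∧
      ∀ η : Euc d, ‖η‖ = 1 → (∀ i j, ⟪η, a i⟫ = ⟪η, a j⟫) → η = θ ∨ η = -θ := by
  have hne : Nonempty ι := Fintype.card_pos_iff.1 (by omega)
  obtain ⟨i₀⟩ := hne
  set V := vectorSpan ℝ (range a) with hV
  have hrank : Module.finrank ℝ V = d - 1 := ha.finrank_vectorSpan (by omega)
  have hperp : Module.finrank ℝ Vᗮ = 1 := by
    have := V.finrank_add_finrank_orthogonal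
    rw [finrank_euclideanSpace_fin] at this
    omega
  have hmem : ∀ η : Euc d, (∀ i j, ⟪η, a i⟫ = ⟪η, a j⟫) → η ∈ Vᗮ := by
    intro η hη
    rw [Submodule.mem_orthogonal']
    intro u hu
    rw [hV, vectorSpan_range_eq_span_range_vsub_right ℝ a i₀] at hu
    induction hu using Submodule.span_induction with
    | mem x hx =>
      obtain ⟨i, rfl⟩ := hx
      simp [inner_sub_right, hη i i₀]
    | zero => simp
    | add x y _ _ hx hy => rw [inner_add_right, hx, hy, add_zero]
    | smul c x _ hx => rw [inner_smul_right, hx, mul_zero]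
  obtain ⟨v, hv0, hv⟩ := finrank_eq_one_iff'.1 hperp
  have hvn : ‖(v : Euc d)‖ ≠ 0 := by simpa using hv0
  refine ⟨‖(v : Euc d)‖⁻¹ • v, ⟪‖(v : Euc d)‖⁻¹ • (v : Euc d), a i₀⟫, ?_, fun i => ?_,
    fun η hη1 hη => ?_⟩
  · rw [norm_smul, norm_inv, norm_norm, inv_mul_cancel₀ hvn]
  · rw [← sub_eq_zero, ← inner_sub_right, real_inner_smul_left, ← vsub_eq_sub,
      Submodule.mem_orthogonal' V v |>.1 v.2 _
        (vsub_mem_vectorSpan ℝ (mem_range_self i) (mem_range_self i₀)), mul_zero]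
  · obtain ⟨c, hc⟩ := hv ⟨η, hmem η hη⟩
    have hc' : η = c • (v : Euc d) := (congrArg Subtype.val hc).symm
    rw [hc', norm_smul, Real.norm_eq_abs] at hη1
    have hinv : |c| = ‖(v : Euc d)‖⁻¹ := eq_inv_of_mul_eq_one_left hη1
    rw [hc', ← hinv, ← neg_smul]
    rcases abs_choice c with h | h
    · exact Or.inl (by rw [h])
    · exact Or.inr (by rw [h, neg_neg])

/-- If `d` affinely independent points lie on a hyperplane and the remaining points lie strictly
on one side of it, at distance at least `ε`, then their convex hull is a facet. -/
theorem mem_edgeEvent_of_separated {n d : ℕ} {W : Submodule ℝ (Euc d)} {I : Finset (Fin n)}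
    (hd : 1 ≤ d) (hI : I.card = d) (hn : ∃ k, k ∉ I) {ω : Fin n → Euc d}
    (hω : AffineIndependent ℝ fun i : {i // i ∈ I} => ω i)
    (hW : (convexHull ℝ (range fun i : {i // i ∈ I} => ω i) ∩ W).Nonempty)
    {θ : Euc d} {t ε : ℝ} (hε : 0 < ε) (hθ : ‖θ‖ = 1) (hin : ∀ i ∈ I, ⟪θ, ω i⟫ = t)
    (hout : ∀ k, k ∉ I → ⟪θ, ω k⟫ ≤ t - ε) :
    ω ∈ edgeEvent W I ∧
      ∀ k, k ∉ I → ε ≤ Metric.infDist (ω k) (affineSpan ℝ (ω '' (I : Set (Fin n)))) := by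
  have hspan : ∀ y ∈ affineSpan ℝ (ω '' (I : Set (Fin n))), ⟪θ, y⟫ = t := by
    intro y hy
    refine affineSpan_induction (p := fun y => ⟪θ, y⟫ = t) hy ?_ fun c u v w hu hv hw => ?_
    · rintro _ ⟨i, hi, rfl⟩
      exact hin i hi
    · simp [inner_add_right, inner_smul_right, inner_sub_right, hu, hv, hw]
  have hle : ∀ k, ⟪θ, ω k⟫ ≤ t := fun k => by
    by_cases hk : k ∈ I
    · exact (hin k hk).le
    · linarith [hout k hk]
  have hle' : ∀ y ∈ convexHull ℝ (range ω), ⟪θ, y⟫ ≤ t := by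
    intro y hy
    obtain ⟨w, ⟨hw0, hw1⟩, rfl⟩ := (mem_convexHull_range_iff ω y).1 hy
    rw [inner_sum, ← one_mul t, ← hw1, Finset.sum_mul]
    exact Finset.sum_le_sum fun i _ => by
      rw [inner_smul_right]
      exact mul_le_mul_of_nonneg_left (hle i) (hw0 i)
  have hface : ∀ y ∈ convexHull ℝ (range ω), ⟪θ, y⟫ = t →
      y ∈ convexHull ℝ (ω '' (I : Set (Fin n))) := by
    intro y hy hyt
    obtain ⟨w, ⟨hw0, hw1⟩, rfl⟩ := (mem_convexHull_range_iff ω y).1 hy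
    have hzero : ∀ k, k ∉ I → w k = 0 := by
      have hsum : ∑ k, w k * (t - ⟪θ, ω k⟫) = 0 := by
        simp_rw [mul_sub, Finset.sum_sub_distrib, ← Finset.sum_mul]
        rw [hw1, one_mul, ← hyt, inner_sum]
        simp [inner_smul_right]
      intro k hk
      have h0 := (Finset.sum_eq_zero_iff_of_nonneg fun i _ =>
        mul_nonneg (hw0 i) (sub_nonneg.2 (hle i))).1 hsum k (Finset.mem_univ k)
      exact (mul_eq_zero.1 h0).resolve_right (by linarith [hout k hk])
    have hsub : ∀ g : Fin n → Euc d, ∑ i ∈ I, w i • g i = ∑ i, w i • g i := fun g =>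
      Finset.sum_subset (Finset.subset_univ I) fun i _ hi => by rw [hzero i hi, zero_smul]
    have hw1' : ∑ i ∈ I, w i = 1 := by
      rw [← hw1]
      exact Finset.sum_subset (Finset.subset_univ I) fun i _ hi => hzero i hi
    rw [← hsub]
    exact (convex_convexHull ℝ _).sum_mem (fun i _ => hw0 i) hw1' fun i hi =>
      subset_convexHull ℝ _ (mem_image_of_mem ω hi)
  have hhull : ∀ y ∈ convexHull ℝ (ω '' (I : Set (Fin n))), ⟪θ, y⟫ = t := fun y hy =>
    hspan y (convexHull_subset_affineSpan _ hy)
  have hIne : ∃ i, i ∈ I := Finset.card_pos.1 (by omega)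
  obtain ⟨i₀, hi₀⟩ := hIne
  refine ⟨⟨⟨fun _ => ⟨innerSL ℝ θ, ?_⟩, ?_, ?_⟩, by rwa [image_coe_eq_range]⟩, fun k hk => ?_⟩
  · ext y
    simp only [innerSL_apply_apply, mem_ofPred_eq]
    refine ⟨fun hy => ⟨convexHull_mono (image_subset_range _ _) hy, fun z hz => ?_⟩,
      fun hy => hface y hy.1 (le_antisymm (hle' y hy.1) ?_)⟩
    · rw [hhull y hy]
      exact hle' z hz
    · rw [← hin i₀ hi₀]
      exact hy.2 _ (subset_convexHull ℝ _ (mem_range_self i₀))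
  · intro heq
    obtain ⟨k, hk⟩ := hn
    have hmem : ω k ∈ convexHull ℝ (ω '' (I : Set (Fin n))) :=
      heq ▸ subset_convexHull ℝ _ (mem_range_self k)
    linarith [hhull _ hmem, hout k hk]
  · rw [vectorSpan_convexHull, image_coe_eq_range,
      hω.finrank_vectorSpan (n := d - 1) (by rw [Fintype.card_coe]; omega)]
    omega
  · have hne : (affineSpan ℝ (ω '' (I : Set (Fin n))) : Set (Euc d)).Nonempty :=
      ⟨ω i₀, subset_affineSpan ℝ _ (mem_image_of_mem ω hi₀)⟩
    refine (Metric.le_infDist hne).2 fun y hy => ?_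
    calc ε ≤ ⟪θ, y - ω k⟫ := by
          rw [inner_sub_right, hspan y hy]
          linarith [hout k hk]
      _ ≤ ‖θ‖ * ‖y - ω k‖ := real_inner_le_norm _ _
      _ = dist (ω k) y := by rw [hθ, one_mul, dist_comm, dist_eq_norm]

/-- The points outside `I` have distance at least `ε` to the affine hull of the points in `I`. -/
def farEvent {n d : ℕ} (I : Finset (Fin n)) (ε : ℝ) : Set (Fin n → Euc d) :=
  {ω | ∀ k, k ∉ I → ε ≤ Metric.infDist (ω k) (affineSpan ℝ (ω '' ↑I) : Set (Euc d))}

/-- The configuration with points `a` at the indices in `I` and points `b` at the others. -/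
def combine {n d : ℕ} (I : Finset (Fin n)) (a : {i // i ∈ I} → Euc d) (b : {i // i ∉ I} → Euc d) :
    Fin n → Euc d :=
  (MeasurableEquiv.piEquivPiSubtypeProd (fun _ => Euc d) (· ∈ I)).symm (a, b)

theorem combine_of_mem {n d : ℕ} {I : Finset (Fin n)} (a : {i // i ∈ I} → Euc d)
    (b : {i // i ∉ I} → Euc d) {i : Fin n} (hi : i ∈ I) : combine I a b i = a ⟨i, hi⟩ :=
  dif_pos hi

theorem combine_of_notMem {n d : ℕ} {I : Finset (Fin n)} (a : {i // i ∈ I} → Euc d)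
    (b : {i // i ∉ I} → Euc d) {i : Fin n} (hi : i ∉ I) : combine I a b i = b ⟨i, hi⟩ :=
  dif_neg hi

/-- The main estimate conditionally on the points with indices in `I`. -/
theorem section_supportedEvent_le {n d : ℕ} {L ε δ : ℝ} (W : Submodule ℝ (Euc d))
    (I : Finset (Fin n)) (μ : Fin n → Measure (Euc d)) [∀ i, IsProbabilityMeasure (μ i)]
    (htrans : ∀ i (v : Euc d) (s : Set (Euc d)), MeasurableSet s →
      μ i ((fun x => x + v) ⁻¹' s) ≤ ENNReal.ofReal (Real.exp (L * ‖v‖)) * μ i s)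
    (hd : 1 ≤ d) (hI : I.card = d) (hn : ∃ k, k ∉ I)
    (hL : 0 ≤ L) (hε0 : 0 < ε) (hε1 : L * ε ≤ 1 / 80) (hδ0 : 0 < δ)
    (hδ : 9 / 10 ≤ δ ^ (4 * (L * ε))) (a : {i // i ∈ I} → Euc d) :
    ENNReal.ofReal (9 / 10) *
        Measure.pi (fun k : {k // k ∉ I} => μ k) (combine I a ⁻¹' supportedEvent W I) ≤
      Measure.pi (fun k : {k // k ∉ I} => μ k) (combine I a ⁻¹' (edgeEvent W I ∩ farEvent I ε)) +
        2 * ENNReal.ofReal (9 / 10 * δ) := by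
  have hcomb : ∀ b, (fun i : {i // i ∈ I} => combine I a b i) = a := fun b =>
    funext fun i => combine_of_mem a b i.2
  by_cases ha : AffineIndependent ℝ a ∧ (convexHull ℝ (range a) ∩ W).Nonempty
  swap
  · have hempty : combine I a ⁻¹' supportedEvent W I = ∅ := by
      refine eq_empty_of_forall_notMem fun b hb => ha ?_
      have h := And.intro hb.1 hb.2.1
      rwa [hcomb b] at h
    simp [hempty]
  obtain ⟨haff, haW⟩ := ha
  obtain ⟨θ, t, hθ, hθt, huniq⟩ := exists_unit_normal hd (by rw [Fintype.card_coe, hI]) haff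
  let slab (η : Euc d) (u : ℝ) : Set ({k // k ∉ I} → Euc d) := univ.pi fun _ => {x | ⟪η, x⟫ ≤ u}
  have hslab_meas : ∀ η u, MeasurableSet (slab η u) := fun η u => MeasurableSet.univ_pi fun _ =>
    (isClosed_le (by fun_prop) continuous_const).measurableSet
  have hupper : combine I a ⁻¹' supportedEvent W I ⊆ slab θ t ∪ slab (-θ) (-t) := by
    rintro b ⟨-, -, η, hη1, hη⟩
    have hIne : ∃ i, i ∈ I := Finset.card_pos.1 (by omega)
    obtain ⟨i₀, hi₀⟩ := hIne
    have hηa : ∀ i j, ⟪η, a i⟫ ≤ ⟪η, a j⟫ := fun i j => by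
      have h := hη j j.2 i
      rwa [combine_of_mem a b j.2, combine_of_mem a b i.2] at h
    have hηb : ∀ k : {k // k ∉ I}, ⟪η, b k⟫ ≤ ⟪η, a ⟨i₀, hi₀⟩⟫ := fun k => by
      have h := hη i₀ hi₀ k
      rwa [combine_of_mem a b hi₀, combine_of_notMem a b k.2] at h
    rcases huniq η hη1 fun i j => le_antisymm (hηa i j) (hηa j i) with rfl | rfl
    · exact Or.inl fun k _ => (hηb k).trans (hθt _).le
    · exact Or.inr fun k _ => (hηb k).trans (by rw [inner_neg_left, hθt])
  have hlower : slab θ (t - ε) ∪ slab (-θ) (-t - ε) ⊆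
      combine I a ⁻¹' (edgeEvent W I ∩ farEvent I ε) := by
    have hside : ∀ (η : Euc d) (u : ℝ), ‖η‖ = 1 → (∀ i, ⟪η, a i⟫ = u) →
        slab η (u - ε) ⊆ combine I a ⁻¹' (edgeEvent W I ∩ farEvent I ε) := by
      intro η u hη1 hηu b hb
      refine mem_edgeEvent_of_separated hd hI hn (by rwa [hcomb b]) (by rwa [hcomb b]) hε0 hη1
        (t := u) (fun i hi => ?_) fun k hk => ?_
      · rw [combine_of_mem a b hi, hηu]
      · rw [combine_of_notMem a b hk]
        exact hb ⟨k, hk⟩ (mem_univ _)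
    exact union_subset (hside θ t hθ hθt)
      (hside (-θ) (-t) (by rw [norm_neg, hθ]) fun i => by rw [inner_neg_left, hθt])
  have hdisj : Disjoint (slab θ (t - ε)) (slab (-θ) (-t - ε)) := by
    obtain ⟨k, hk⟩ := hn
    refine Set.disjoint_left.2 fun b hb hb' => ?_
    have h1 : ⟪θ, b ⟨k, hk⟩⟫ ≤ t - ε := hb ⟨k, hk⟩ (mem_univ _)
    have h2 : ⟪-θ, b ⟨k, hk⟩⟫ ≤ -t - ε := hb' ⟨k, hk⟩ (mem_univ _)
    rw [inner_neg_left] at h2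
    linarith
  have hbound : ∀ (η : Euc d) (u : ℝ), ‖η‖ = 1 →
      ENNReal.ofReal (9 / 10) * Measure.pi (fun k : {k // k ∉ I} => μ k) (slab η u) ≤
        Measure.pi (fun k : {k // k ∉ I} => μ k) (slab η (u - ε)) +
          ENNReal.ofReal (9 / 10 * δ) := by
    intro η u hη1
    rw [Measure.pi_pi, Measure.pi_pi]
    exact prod_halfSpace_le (fun k : {k // k ∉ I} => μ k) (fun k => htrans k) hL hε0.le hε1 hδ0 hδ
      η hη1 u
  set ν := Measure.pi fun k : {k // k ∉ I} => μ k
  calc ENNReal.ofReal (9 / 10) * ν (combine I a ⁻¹' supportedEvent W I)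
      ≤ ENNReal.ofReal (9 / 10) * (ν (slab θ t) + ν (slab (-θ) (-t))) := by
        gcongr
        exact (measure_mono hupper).trans (measure_union_le _ _)
    _ ≤ (ν (slab θ (t - ε)) + ENNReal.ofReal (9 / 10 * δ)) +
          (ν (slab (-θ) (-t - ε)) + ENNReal.ofReal (9 / 10 * δ)) := by
        rw [mul_add]
        exact add_le_add (hbound θ t hθ) (hbound (-θ) (-t) (by rw [norm_neg, hθ]))
    _ = ν (slab θ (t - ε) ∪ slab (-θ) (-t - ε)) + 2 * ENNReal.ofReal (9 / 10 * δ) := by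
        rw [measure_union hdisj (hslab_meas _ _)]
        ring
    _ ≤ _ := by
        gcongr

theorem lintegral_section_le_prod {α β : Type*} [MeasurableSpace α] [MeasurableSpace β]
    (μ : Measure α) (ν : Measure β) [SFinite ν] (s : Set (α × β)) :
    ∫⁻ x, ν (Prod.mk x ⁻¹' s) ∂μ ≤ μ.prod ν s := by
  rw [← measure_toMeasurable s, Measure.prod_apply (measurableSet_toMeasurable _ _)]
  exact lintegral_mono fun x => measure_mono (preimage_mono (subset_toMeasurable _ _))

theorem measure_supportedEvent_le {n d : ℕ} {L ε δ : ℝ} (W : Submodule ℝ (Euc d))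
    (I : Finset (Fin n)) (μ : Fin n → Measure (Euc d)) [∀ i, IsProbabilityMeasure (μ i)]
    (htrans : ∀ i (v : Euc d) (s : Set (Euc d)), MeasurableSet s →
      μ i ((fun x => x + v) ⁻¹' s) ≤ ENNReal.ofReal (Real.exp (L * ‖v‖)) * μ i s)
    (hd : 1 ≤ d) (hI : I.card = d) (hn : ∃ k, k ∉ I)
    (hL : 0 ≤ L) (hε0 : 0 < ε) (hε1 : L * ε ≤ 1 / 80) (hδ0 : 0 < δ)
    (hδ : 9 / 10 ≤ δ ^ (4 * (L * ε))) :
    ENNReal.ofReal (9 / 10) * Measure.pi μ (supportedEvent W I) ≤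
      Measure.pi μ (edgeEvent W I ∩ farEvent I ε) + 2 * ENNReal.ofReal (9 / 10 * δ) := by
  set e := MeasurableEquiv.piEquivPiSubtypeProd (fun _ : Fin n => Euc d) (· ∈ I)
  set μI := Measure.pi fun i : {i // i ∈ I} => μ i
  set ν := Measure.pi fun i : {i // i ∉ I} => μ i
  have hpres : MeasurePreserving e.symm (μI.prod ν) (Measure.pi μ) := by
    convert! (measurePreserving_piEquivPiSubtypeProd μ (· ∈ I)).symm e
  rw [← hpres.measure_preimage_equiv (supportedEvent W I),
    ← hpres.measure_preimage_equiv (edgeEvent W I ∩ farEvent I ε),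
    Measure.prod_apply (e.symm.measurable (measurableSet_supportedEvent W I)),
    ← lintegral_const_mul' _ _ ENNReal.ofReal_ne_top]
  calc ∫⁻ a, ENNReal.ofReal (9 / 10) * ν (Prod.mk a ⁻¹' (e.symm ⁻¹' supportedEvent W I)) ∂μI
      ≤ ∫⁻ a, (ν (Prod.mk a ⁻¹' (e.symm ⁻¹' (edgeEvent W I ∩ farEvent I ε))) +
          2 * ENNReal.ofReal (9 / 10 * δ)) ∂μI :=
        lintegral_mono fun a =>
          section_supportedEvent_le W I μ htrans hd hI hn hL hε0 hε1 hδ0 hδ a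
    _ = (∫⁻ a, ν (Prod.mk a ⁻¹' (e.symm ⁻¹' (edgeEvent W I ∩ farEvent I ε))) ∂μI) +
          2 * ENNReal.ofReal (9 / 10 * δ) := by
        rw [lintegral_add_right _ measurable_const, lintegral_const, measure_univ, mul_one]
    _ ≤ _ := by
        gcongr
        exact lintegral_section_le_prod _ _ _

/-- The numerical constraints on the separation `ε = 1 / (10 e³ d L log n)`. -/
theorem separation_bounds {n d : ℕ} {L : ℝ} (hL : 0 < L) (hd : 1 ≤ d) (hn : 3 ≤ n) (hdn : d ≤ n) :
    0 < 1 / (10 * Real.exp 1 ^ 3 * d * L * Real.log n) ∧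
      L * (1 / (10 * Real.exp 1 ^ 3 * d * L * Real.log n)) ≤ 1 / 80 ∧
      9 / 10 ≤ (1 / (n.choose d : ℝ)) ^
        (4 * (L * (1 / (10 * Real.exp 1 ^ 3 * d * L * Real.log n)))) := by
  have he : (2 : ℝ) ≤ Real.exp 1 := by linarith [Real.add_one_le_exp (1 : ℝ)]
  have he3 : (8 : ℝ) ≤ Real.exp 1 ^ 3 := by
    calc (8 : ℝ) = 2 ^ 3 := by norm_num
      _ ≤ _ := by gcongr
  have hd1 : (1 : ℝ) ≤ d := by exact_mod_cast hd
  have hn3 : (3 : ℝ) ≤ n := by exact_mod_cast hn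
  have hlog : 1 ≤ Real.log n := by
    rw [Real.le_log_iff_exp_le (by linarith)]
    linarith [Real.exp_one_lt_d9]
  set D := d * Real.log n with hD
  have hD1 : 1 ≤ D := one_le_mul_of_one_le_of_one_le hd1 hlog
  have hc : L * (1 / (10 * Real.exp 1 ^ 3 * d * L * Real.log n)) =
      1 / (10 * Real.exp 1 ^ 3 * D) := by
    rw [hD]
    field_simp
  rw [hc]
  refine ⟨by positivity, ?_, ?_⟩
  · refine one_div_le_one_div_of_le (by norm_num) ?_
    nlinarith
  · have hC : (0 : ℝ) < n.choose d := by exact_mod_cast Nat.choose_pos hdn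
    have hlogC : Real.log (n.choose d) ≤ D := by
      have h : (n.choose d : ℝ) ≤ (n : ℝ) ^ d := by exact_mod_cast Nat.choose_le_pow n d
      have h' := Real.log_le_log hC h
      rwa [Real.log_pow] at h'
    rw [Real.rpow_def_of_pos (by positivity), one_div, Real.log_inv]
    refine le_trans ?_ (Real.add_one_le_exp _)
    have hcD : 1 / (10 * Real.exp 1 ^ 3 * D) * D ≤ 1 / 80 := by
      rw [one_div, mul_inv, inv_mul_cancel_right₀ (by positivity), ← one_div]
      exact one_div_le_one_div_of_le (by norm_num) (by linarith)
    have hc0 : 0 ≤ 1 / (10 * Real.exp 1 ^ 3 * D) := by positivity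
    nlinarith [mul_le_mul_of_nonneg_left hlogC hc0]

/-- lower bound for the facet-to-vertex distance δ.
Let `a_1,…,a_n ∈ ℝ^d` be independent with `L`-log-Lipschitz densities and `W ⊆ ℝ^d` a
two-dimensional subspace.  For every `I` of size `d` with `Pr[E_I] ≥ 10 (n choose d)⁻¹`,
`Pr[ min_{k ∉ I} dist(affhull F_I, a_k) ≥ 1/(10 e³ d L log n) | E_I ] ≥ 0.72`. -/
theorem stmt_7 (n d : ℕ) (L : ℝ) (hL : 0 < L)
    (W : Submodule ℝ (Euc d)) (hW : Module.finrank ℝ W = 2)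
    (f : Fin n → Euc d → ℝ) (hf : ∀ i, IsLogLipschitz L (f i))
    (hnorm : ∀ i, ∫⁻ x, ENNReal.ofReal (f i x) = 1)
    (I : Finset (Fin n)) (hI : I.card = d)
    (hPE : (10 : ℝ≥0∞) / (n.choose d) ≤ productDensityMeasure f (edgeEvent W I)) :
    (72/100 : ℝ≥0∞) ≤ (productDensityMeasure f)[|edgeEvent W I]
      {ω | ∀ k, k ∉ I →
        1 / (10 * Real.exp 1 ^ 3 * d * L * Real.log n) ≤
          Metric.infDist (ω k) (affineSpan ℝ (ω '' ↑I) : Set (Euc d))} := by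
  set ε := 1 / (10 * Real.exp 1 ^ 3 * d * L * Real.log n)
  have hd : 2 ≤ d := by
    have h := W.finrank_le
    rwa [hW, finrank_euclideanSpace_fin] at h
  have hdn : d ≤ n := by
    rw [← hI]
    simpa using Finset.card_le_univ I
  have hprob : ∀ i, IsProbabilityMeasure (volume.withDensity fun x => ENNReal.ofReal (f i x)) :=
    fun i => ⟨by simp [hnorm i]⟩
  rw [productDensityMeasure_eq_pi (fun i => (hf i).continuous hL) (fun i => (hf i).1) hnorm]
    at hPE ⊢
  set P := Measure.pi fun i => volume.withDensity fun x => ENNReal.ofReal (f i x)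
  have hdn' : d < n := by
    refine lt_of_le_of_ne hdn ?_
    rintro rfl
    have h := hPE.trans prob_le_one
    rw [Nat.choose_self, Nat.cast_one, div_one] at h
    norm_num at h
  have hout : ∃ k, k ∉ I := by
    by_contra! h
    rw [Finset.eq_univ_iff_forall.2 h, Finset.card_univ, Fintype.card_fin] at hI
    omega
  obtain ⟨hε0, hε1, hδ⟩ := separation_bounds hL (by omega : 1 ≤ d) (by omega : 3 ≤ n) hdn
  have hmain := measure_supportedEvent_le W I
    (fun i => volume.withDensity fun x => ENNReal.ofReal (f i x))
    (fun i v s hs => (hf i).measure_preimage_add_le v hs) (by omega) hI hout hL.le hε0 hε1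
    (one_div_pos.2 (by exact_mod_cast Nat.choose_pos hdn)) hδ
  have hsub : P (edgeEvent W I) ≤ P (supportedEvent W I) :=
    measure_mono (edgeEvent_subset_supportedEvent W I hI)
  have hkey : (72 / 100 : ℝ≥0∞) * P (edgeEvent W I) ≤ P (edgeEvent W I ∩ farEvent I ε) := by
    have hPE' := ENNReal.toReal_mono (measure_ne_top _ _) hPE
    have hmain' := ENNReal.toReal_mono (by finiteness) hmain
    have hsub' := ENNReal.toReal_mono (measure_ne_top _ _) hsub
    have hδ0 : 0 ≤ 9 / 10 * (1 / (n.choose d : ℝ)) := by positivity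
    rw [ENNReal.toReal_add (by finiteness) (by finiteness), ENNReal.toReal_mul, ENNReal.toReal_mul,
      ENNReal.toReal_ofReal (by norm_num), ENNReal.toReal_ofReal hδ0, ENNReal.toReal_ofNat]
      at hmain'
    rw [ENNReal.toReal_div, ENNReal.toReal_ofNat, ENNReal.toReal_natCast, div_eq_mul_one_div]
      at hPE'
    rw [← ENNReal.toReal_le_toReal (by finiteness) (by finiteness), ENNReal.toReal_mul,
      ENNReal.toReal_div, ENNReal.toReal_ofNat, ENNReal.toReal_ofNat]
    linarith
  have hpos : P (edgeEvent W I) ≠ 0 := by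
    refine (lt_of_lt_of_le ?_ hPE).ne'
    exact ENNReal.div_pos (by norm_num) (ENNReal.natCast_ne_top _)
  calc (72 / 100 : ℝ≥0∞) = (P (edgeEvent W I))⁻¹ * (72 / 100 * P (edgeEvent W I)) := by
        rw [mul_comm, mul_assoc, ENNReal.mul_inv_cancel hpos (measure_ne_top _ _), mul_one]
    _ ≤ (P (edgeEvent W I))⁻¹ * P.restrict (edgeEvent W I) (farEvent I ε) := by
        gcongr
        refine hkey.trans ?_
        rw [inter_comm]
        exact Measure.le_restrict_apply _ _
    _ = _ := rfl
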